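/- Let R be a local nearring with identity a whose additive group is the Heisenberg group of order p^3 (p odd prime), with generators a, b, c as usual, derived subgroup ⟨c⟩, and subgroup of non-invertible elements L = ⟨b⟩ + ⟨c⟩. Write xb = α(x)a + β(x)b + γ(x)c. Then α(x) ≡ 0 (mod p) for all x ∈ R, and if β(x) ≡ 0 (mod p) then x is non-invertible (equivalently x1 ≡ 0 mod p, where x = x1·a + x2·b + x3·c). -/

import Mathlib

theorem nsmul_mod_eq_of_nsmul_eq_zero {M : Type*} [AddMonoid M] {p : ℕ} {g : M}
    (hg : p • g = 0) (m : ℕ) : (m % p) • g = m • g := by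
  conv_rhs => rw [← Nat.mod_add_div m p, add_nsmul, mul_nsmul, hg, nsmul_zero, add_zero]

/-- Let `R` be a local nearring with identity `a` whose additive group is the
Heisenberg group of order `p³`, with generators `a, b, c`, derived subgroup
`⟨c⟩`, and subgroup of non-invertible elements `L = ⟨b⟩ + ⟨c⟩`.  Writing
`x·b = α(x)a + β(x)b + γ(x)c`, one has `α(x) ≡ 0 (mod p)` for all `x`, and if
`β(x) ≡ 0 (mod p)` then `x₁ ≡ 0 (mod p)`. -/
theorem local_nearring_G1_alpha_beta (p : ℕ) (hp : p.Prime) (hodd : Odd p)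
    {R : Type*} [AddGroup R] (mul : R → R → R)
    (hassoc : ∀ x y z : R, mul (mul x y) z = mul x (mul y z))
    (hdist : ∀ x y z : R, mul x (y + z) = mul x y + mul x z)
    (a b c : R)
    (hpa : p • a = 0) (hpb : p • b = 0) (hpc : p • c = 0)
    (hab : a + b = b + a + c) (hac : a + c = c + a) (hbc : b + c = c + b)
    (hid : ∀ x : R, mul a x = x ∧ mul x a = x)
    (x1 x2 x3 : R → ℕ)
    (hcoord : ∀ x : R, x1 x < p ∧ x2 x < p ∧ x3 x < p ∧
      x = x1 x • a + x2 x • b + x3 x • c)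
    (huniq : ∀ m n r m' n' r' : ℕ, m < p → n < p → r < p → m' < p → n' < p → r' < p →
      m • a + n • b + r • c = m' • a + n' • b + r' • c → m = m' ∧ n = n' ∧ r = r')
    (α β γ : R → ℕ)
    (hαβγ : ∀ x : R, α x < p ∧ β x < p ∧ γ x < p ∧
      mul x b = α x • a + β x • b + γ x • c)
    (L : Set R) (hLdef : L = {z : R | ∃ m n : ℕ, z = m • b + n • c})
    (hLmul : ∀ x z : R, z ∈ L → mul x z ∈ L)
    (hLinv : ∀ x : R, (∃ v : R, mul x v = a ∧ mul v x = a) ↔ x ∉ L) :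
    ∀ x : R, p ∣ α x ∧ (p ∣ β x → p ∣ x1 x) := by
  have coord_zero : ∀ k s t : ℕ, k < p → s < p → t < p →
      k • a + s • b + t • c ∈ L → k = 0 := by
    intro k s t hk hs ht hmem
    rw [hLdef] at hmem
    obtain ⟨m, n, h⟩ := hmem
    refine (huniq k s t 0 (m % p) (n % p) hk hs ht hp.pos (Nat.mod_lt _ hp.pos)
      (Nat.mod_lt _ hp.pos) ?_).1
    rw [h, nsmul_mod_eq_of_nsmul_eq_zero hpb, nsmul_mod_eq_of_nsmul_eq_zero hpc, zero_nsmul,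
      zero_add]
  have central : ∀ (n : ℕ) (y : R), AddCommute (n • c) y := by
    intro n y
    have hca : AddCommute c a := hac.symm
    have hcb : AddCommute c b := hbc.symm
    rw [(hcoord y).2.2.2]
    exact (((hca.nsmul_right _).add_right (hcb.nsmul_right _)).add_right
      ((AddCommute.refl c).nsmul_right _)).nsmul_left n
  have c_ne_zero : c ≠ 0 := by
    intro hc
    have h := (huniq 0 0 1 0 0 0 hp.pos hp.pos hp.one_lt hp.pos hp.pos hp.pos
      (by simp [hc])).2.2
    exact one_ne_zero h
  have b_mem : b ∈ L := by
    rw [hLdef]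
    exact ⟨1, 0, by simp⟩
  intro x
  obtain ⟨hα, hβ, hγ, hxb⟩ := hαβγ x
  have hα0 : α x = 0 := coord_zero _ _ _ hα hβ hγ (hxb ▸ hLmul x b b_mem)
  refine ⟨hα0 ▸ dvd_zero p, fun hdvd => ?_⟩
  have hβ0 : β x = 0 := Nat.eq_zero_of_dvd_of_lt hdvd hβ
  have hxL : x ∈ L := by
    by_contra hx
    obtain ⟨v, -, hvx⟩ := (hLinv x).2 hx
    have hvxy : ∀ y, mul v (mul x y) = y := fun y => by rw [← hassoc, hvx, (hid y).1]
    have hcomm : mul x b + mul x a = mul x a + mul x b := by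
      rw [hxb, hα0, hβ0, zero_nsmul, zero_nsmul, zero_add, zero_add]
      exact (central _ _).eq
    have hba : b + a = a + b := by
      simpa only [hdist, hvxy] using congrArg (mul v) hcomm
    exact c_ne_zero (left_eq_add.1 (hba.trans hab))
  obtain ⟨h1, h2, h3, hx⟩ := hcoord x
  have hx1 : x1 x = 0 := coord_zero _ _ _ h1 h2 h3 (hx ▸ hxL)
  exact hx1 ▸ dvd_zero p
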